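/- Morawetz-type multiplier identities. Let Ω ⊆ ℝⁿ be open, v ∈ H²_loc(Ω), λ, ε ∈ ℝ, a(x): Ω → ℝ^{n×n} symmetric, b(x): Ω → ℝⁿ, and c, φ, ψ: Ω → ℝ sufficiently smooth. Set f := Aᵇv − c(x)v + (λ + iε)v, where Aᵇv = ∂ⱼᵇ(a_{jk}∂ₖᵇv), ∂ⱼᵇ = ∂ⱼ + ibⱼ, and Aψ = ∂ⱼ(a_{jk}∂ₖψ). Then the identity I_{∇v} + I_v + I_ε + I_b + I_f = Re ∂ⱼ{Qⱼ + Pⱼ} holds, where: I_f = Re[(Aψ + φ)v̄ f + 2a(∇ψ, ∇ᵇv)f]; I_{∇v} = α_{ℓm} Re(∂ₘᵇv ∂ₗᵇv̄) + a(∇ᵇv, ∇ᵇv)φ with α_{ℓm} = 2a_{jm}∂ⱼ(a_{ℓk}∂ₖψ) − a_{jk}∂ₖψ ∂ⱼa_{ℓm}; I_v = −(1/2)A(Aψ + φ)|v|² − [a(∇ψ, ∇c) − cφ + λφ]|v|²; I_ε = 2ε Im[a(∇ψ, ∇ᵇv)v]; I_b = 2 Im[a_{jk}∂ₖᵇv (∂ⱼbₗ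 − ∂ₗbⱼ)a_{ℓm}∂ₘψ v̄]; Qⱼ = a_{jk}∂ₖᵇv · [Aᵇ, ψ]v̄ − (1/2)a_{jk}(∂ₖAψ)|v|² − a_{jk}∂ₖψ[(c − λ)|v|² + a(∇ᵇv, ∇ᵇv)]; Pⱼ = a_{jk}∂ₖᵇv φ v̄ − (1/2)a_{jk}∂ₖφ |v|². Moreover ∂ⱼPⱼ = a(∇ᵇv, ∇ᵇv)φ + (c − λ − iε)|v|²φ + f v̄ φ − (1/2)Aφ|v|² + i Im a(∇ᵇv, v∇φ). -/

import Mathlib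

/-!
Common definitions for the formalization of
"On the supercritical defocusing NLW ..." — actually:
D'Ancona, *A short proof of the limiting absorption principle for a
generalized Helmholtz equation* (arXiv:1612.00950).

We work on `EuclideanSpace ℝ (Fin n)`.  Sobolev-type regularity is
represented by classical (`ContDiffOn`) regularity together with the
relevant integrability conditions; derivatives are the classical
`fderiv` derivatives.
-/

noncomputable section

open MeasureTheory Real Filter Set Metric
open scoped Topology BigOperators ComplexConjugate

namespace Helmholtz

abbrev Euc (n : ℕ) := EuclideanSpace ℝ (Fin n)

variable {n : ℕ}

/-- `j`-th partial derivative of a complex-valued function. -/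
def pdC (j : Fin n) (w : Euc n → ℂ) (x : Euc n) : ℂ :=
  fderiv ℝ w x (EuclideanSpace.single j 1)

/-- `j`-th partial derivative of a real-valued function. -/
def pdR (j : Fin n) (g : Euc n → ℝ) (x : Euc n) : ℝ :=
  fderiv ℝ g x (EuclideanSpace.single j 1)

/-- the magnetic derivative `∂ⱼᵇ = ∂ⱼ + i bⱼ`. -/
def pdB (b : Euc n → Fin n → ℝ) (j : Fin n) (w : Euc n → ℂ) (x : Euc n) : ℂ :=
  pdC j w x + Complex.I * (b x j : ℂ) * w x

/-- the magnetic gradient `∇ᵇ = ∇ + i b`. -/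
def gradB (b : Euc n → Fin n → ℝ) (w : Euc n → ℂ) (x : Euc n) : Fin n → ℂ :=
  fun j => pdB b j w x

/-- squared euclidean norm of a complex vector. -/
def vnormSq (w : Fin n → ℂ) : ℝ := ∑ j, Complex.normSq (w j)

/-- euclidean norm of a real vector. -/
def rvnorm (w : Fin n → ℝ) : ℝ := Real.sqrt (∑ j, (w j) ^ 2)

/-- the unit radial vector `x̂ = x/|x|`. -/
def xhat (x : Euc n) : Fin n → ℝ := fun j => x j / ‖x‖

/-- the Sommerfeld magnetic gradient `∇ᵇ_S = ∇ᵇ − i √λ x̂`. -/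
def gradBS (b : Euc n → Fin n → ℝ) (lam : ℝ) (w : Euc n → ℂ) (x : Euc n) : Fin n → ℂ :=
  fun j => pdB b j w x - Complex.I * (Real.sqrt lam : ℂ) * (xhat x j : ℂ) * w x

/-- `Aᵇ v = ∇ᵇ ⋅ (a ∇ᵇ v)`. -/
def Aop (a : Euc n → Matrix (Fin n) (Fin n) ℝ) (b : Euc n → Fin n → ℝ)
    (v : Euc n → ℂ) (x : Euc n) : ℂ :=
  ∑ j, pdB b j (fun y => ∑ k, (a y j k : ℂ) * pdB b k v y) x

/-- the operator `L = ∇ᵇ ⋅ (a ∇ᵇ ⋅) + c`. -/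
def Lop (a : Euc n → Matrix (Fin n) (Fin n) ℝ) (b : Euc n → Fin n → ℝ) (c : Euc n → ℝ)
    (v : Euc n → ℂ) (x : Euc n) : ℂ :=
  Aop a b v x + (c x : ℂ) * v x

/-- `A ψ = ∇ ⋅ (a ∇ ψ)` for a real weight `ψ`. -/
def AopR (a : Euc n → Matrix (Fin n) (Fin n) ℝ) (ψ : Euc n → ℝ) (x : Euc n) : ℝ :=
  ∑ j, pdR j (fun y => ∑ k, a y j k * pdR k ψ y) x

/-- the sesquilinear form `a(w,z) = a_{jk} w_k z̄_j`. -/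
def aF (a : Euc n → Matrix (Fin n) (Fin n) ℝ) (x : Euc n) (w z : Fin n → ℂ) : ℂ :=
  ∑ j, ∑ k, (a x j k : ℂ) * w k * conj (z j)

/-- the vector `a ∇ᵇ v`. -/
def aGradB (a : Euc n → Matrix (Fin n) (Fin n) ℝ) (b : Euc n → Fin n → ℝ)
    (v : Euc n → ℂ) (x : Euc n) : Fin n → ℂ :=
  fun j => ∑ k, (a x j k : ℂ) * pdB b k v x

/-- tangential part `w_T = w − (x̂·w) x̂` of a complex vector. -/
def tang (x : Euc n) (w : Fin n → ℂ) : Fin n → ℂ :=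
  fun j => w j - (∑ k, (xhat x k : ℂ) * w k) * (xhat x j : ℂ)

/-- the dyadic annulus `{2ʲ ≤ |x| < 2^{j+1}}`. -/
def ann (n : ℕ) (j : ℤ) : Set (Euc n) := {x | (2 : ℝ) ^ j ≤ ‖x‖ ∧ ‖x‖ < (2 : ℝ) ^ (j + 1)}

/-- sup of `|g|` on a set. -/
def ssup (S : Set (Euc n)) (g : Euc n → ℝ) : ℝ := ⨆ x : S, |g (x : Euc n)|

/-- the `L^∞(Ω)` norm. -/
def supNorm (Ω : Set (Euc n)) (g : Euc n → ℝ) : ℝ := ssup Ω g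

/-- the dyadic `ℓ¹L^∞` norm. -/
def l1Linf (Ω : Set (Euc n)) (g : Euc n → ℝ) : ℝ := ∑' j : ℤ, ssup (Ω ∩ ann n j) g

/-- the dyadic `ℓ²L^∞` norm. -/
def l2Linf (Ω : Set (Euc n)) (g : Euc n → ℝ) : ℝ :=
  Real.sqrt (∑' j : ℤ, (ssup (Ω ∩ ann n j) g) ^ 2)

/-- the norm of the space `Ẏ*`, `‖f‖ = ‖ |x|^{1/2} f ‖_{ℓ¹L²}`. -/
def Ystar (Ω : Set (Euc n)) (f : Euc n → ℂ) : ℝ :=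
  ∑' j : ℤ, Real.sqrt (∫ x in Ω ∩ ann n j, ‖x‖ * ‖f x‖ ^ 2)

/-- `sup_{R>0} R⁻¹ ∫_{Ω∩{|x|≤R}} g`. -/
def YsupSq (Ω : Set (Euc n)) (g : Euc n → ℝ) : ℝ :=
  ⨆ R : {r : ℝ // 0 < r}, ((R : ℝ))⁻¹ * ∫ x in Ω ∩ closedBall (0 : Euc n) (R : ℝ), g x

/-- the `Ẏ` norm of `v`. -/
def Ynorm (Ω : Set (Euc n)) (v : Euc n → ℂ) : ℝ :=
  Real.sqrt (YsupSq Ω fun x => ‖v x‖ ^ 2)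

/-- the `Ẏ` norm of the magnetic gradient `∇ᵇ v`. -/
def YnormG (Ω : Set (Euc n)) (b : Euc n → Fin n → ℝ) (v : Euc n → ℂ) : ℝ :=
  Real.sqrt (YsupSq Ω fun x => vnormSq (gradB b v x))

/-- membership in the space `Ẏ` (finiteness of the `Ẏ` norm). -/
def MemY (Ω : Set (Euc n)) (v : Euc n → ℂ) : Prop :=
  BddAbove (Set.range fun R : {r : ℝ // 0 < r} =>
    ((R : ℝ))⁻¹ * ∫ x in Ω ∩ closedBall (0 : Euc n) (R : ℝ), ‖v x‖ ^ 2)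

/-- surface integral on `Ω ∩ {|x| = R}` with respect to the `(n−1)`-dimensional
Hausdorff (surface) measure. -/
def sphInt (Ω : Set (Euc n)) (g : Euc n → ℝ) (R : ℝ) : ℝ :=
  ∫ x in Ω ∩ sphere (0 : Euc n) R, g x
    ∂(MeasureTheory.Measure.hausdorffMeasure ((n : ℝ) - 1))

/-- `sup_{R>0} R⁻² ∫_{Ω∩{|x|=R}} g dS`. -/
def XsupSq (Ω : Set (Euc n)) (g : Euc n → ℝ) : ℝ :=
  ⨆ R : {r : ℝ // 0 < r}, (((R : ℝ)) ^ 2)⁻¹ * sphInt Ω g (R : ℝ)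

/-- the `Ẋ` norm. -/
def Xnorm (Ω : Set (Euc n)) (v : Euc n → ℂ) : ℝ :=
  Real.sqrt (XsupSq Ω fun x => ‖v x‖ ^ 2)

/-- sup of `|g|` on `Ω` intersected with the sphere of radius `ρ`. -/
def sphSup (Ω : Set (Euc n)) (g : Euc n → ℝ) (ρ : ℝ) : ℝ :=
  ssup (Ω ∩ sphere (0 : Euc n) ρ) g

/-- mixed dyadic norm `ℓ¹L²L^∞` (radial `L²` of the angular sup). -/
def l1L2Linf (Ω : Set (Euc n)) (g : Euc n → ℝ) : ℝ :=
  ∑' j : ℤ, Real.sqrt (∫ ρ in Set.Ico ((2 : ℝ) ^ j) ((2 : ℝ) ^ (j + 1)), (sphSup Ω g ρ) ^ 2)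

/-- mixed dyadic norm `ℓ¹L¹L^∞`. -/
def l1L1Linf (Ω : Set (Euc n)) (g : Euc n → ℝ) : ℝ :=
  ∑' j : ℤ, ∫ ρ in Set.Ico ((2 : ℝ) ^ j) ((2 : ℝ) ^ (j + 1)), sphSup Ω g ρ

/-- (a) matrix norm. -/
def matNorm (m : Matrix (Fin n) (Fin n) ℝ) : ℝ := ∑ j, ∑ k, |m j k|

/-- `|a′|`: sum of the moduli of all first order derivatives of the entries. -/
def aD1 (a : Euc n → Matrix (Fin n) (Fin n) ℝ) (x : Euc n) : ℝ :=
  ∑ i, ∑ j, ∑ k, |pdR i (fun y => a y j k) x|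

/-- `|a″|`. -/
def aD2 (a : Euc n → Matrix (Fin n) (Fin n) ℝ) (x : Euc n) : ℝ :=
  ∑ i, ∑ i', ∑ j, ∑ k, |pdR i (fun y => pdR i' (fun z => a z j k) y) x|

/-- `|a‴|`. -/
def aD3 (a : Euc n → Matrix (Fin n) (Fin n) ℝ) (x : Euc n) : ℝ :=
  ∑ i, ∑ i', ∑ i'', ∑ j, ∑ k,
    |pdR i (fun y => pdR i' (fun z => pdR i'' (fun u => a u j k) z) y) x|

/-- `C_a(x) = |a−I| + |x||a′| + |x|²|a″| + |x|³|a‴|`. -/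
def Ca (a : Euc n → Matrix (Fin n) (Fin n) ℝ) (x : Euc n) : ℝ :=
  matNorm (a x - 1) + ‖x‖ * aD1 a x + ‖x‖ ^ 2 * aD2 a x + ‖x‖ ^ 3 * aD3 a x

/-- `|b′|`. -/
def bD1 (b : Euc n → Fin n → ℝ) (x : Euc n) : ℝ :=
  ∑ i, ∑ j, |pdR i (fun y => b y j) x|

/-- the magnetic field matrix `db = [∂ⱼbₗ − ∂ₗbⱼ]`. -/
def dbM (b : Euc n → Fin n → ℝ) (x : Euc n) : Matrix (Fin n) (Fin n) ℝ :=
  fun j l => pdR j (fun y => b y l) x - pdR l (fun y => b y j) x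

/-- the tangential part of the magnetic field, `d̂b = db · a · x̂`. -/
def dbHat (a : Euc n → Matrix (Fin n) (Fin n) ℝ) (b : Euc n → Fin n → ℝ) (x : Euc n) :
    Fin n → ℝ :=
  fun j => ∑ l, dbM b x j l * ∑ m, a x l m * xhat x m

/-- the radial derivative `∂_r = x̂ ⋅ ∇`. -/
def radD (g : Euc n → ℝ) (x : Euc n) : ℝ := ∑ j, xhat x j * pdR j g x

/-- `|∇g|`. -/
def gradRNorm (g : Euc n → ℝ) (x : Euc n) : ℝ := rvnorm fun j => pdR j g x

/-- positive part. -/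
def pos (t : ℝ) : ℝ := max t 0

/-- negative part. -/
def neg (t : ℝ) : ℝ := max (-t) 0

/-- the japanese bracket `⟨x⟩ = (1+|x|²)^{1/2}`. -/
def jap (x : Euc n) : ℝ := Real.sqrt (1 + ‖x‖ ^ 2)

/-- membership in the weak (Lorentz) space `L^{p,∞}(Ω)`. -/
def MemWeakLp (Ω : Set (Euc n)) (g : Euc n → ℝ) (p : ℝ) : Prop :=
  ∃ C : ℝ, ∀ t : ℝ, 0 < t →
    volume (Ω ∩ {x | t < |g x|}) ≤ ENNReal.ofReal (C / t ^ p)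

/-- Dirichlet boundary condition `v|_{∂Ω} = 0`. -/
def BdZero (Ω : Set (Euc n)) (v : Euc n → ℂ) : Prop := ∀ x ∈ frontier Ω, v x = 0

/-- the asymptotic flux condition
`liminf_{R→∞} ∫_{|x|=R} (|∇ᵇv|² + |v|²) dS = 0`. -/
def VanishAtInfty (Ω : Set (Euc n)) (b : Euc n → Fin n → ℝ) (v : Euc n → ℂ) : Prop :=
  Filter.liminf (fun R => sphInt Ω (fun x => vnormSq (gradB b v x) + ‖v x‖ ^ 2) R)
    Filter.atTop = 0

/-- the Sommerfeld radiation condition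
`liminf_{R→∞} ∫_{|x|=R} |∇ᵇv − i x̂ √λ v|² dS = 0`. -/
def Sommerfeld (Ω : Set (Euc n)) (b : Euc n → Fin n → ℝ) (lam : ℝ) (v : Euc n → ℂ) : Prop :=
  Filter.liminf (fun R => sphInt Ω (fun x => vnormSq (gradBS b lam v x)) R) Filter.atTop = 0

/-- `Ω` has a `C¹` boundary which is starshaped with respect to the metric `a`:
`a(x) x ⋅ ν(x) ≤ 0` on `∂Ω`, where `ν` is the exterior normal (here written using a
`C¹` defining function `ρ`, with `Ω = {ρ > 0}` so that `ν = −∇ρ/|∇ρ|` on `∂Ω`). -/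
def StarshapedC1 (Ω : Set (Euc n)) (a : Euc n → Matrix (Fin n) (Fin n) ℝ) : Prop :=
  ∃ ρ : Euc n → ℝ, ContDiff ℝ 1 ρ ∧ Ω = {x | 0 < ρ x} ∧
    ∀ x ∈ frontier Ω, fderiv ℝ ρ x ≠ 0 ∧
      0 ≤ ∑ j, (∑ k, a x j k * x k) * pdR j ρ x

/-- geometric and structural setup: `Ω ⊂ ℝⁿ`, `n ≥ 3`, is the open exterior of a compact
obstacle with `C¹` boundary, starshaped with respect to the real, symmetric,
positive definite metric `a`. -/
structure Setup (n : ℕ) (Ω : Set (Euc n)) (a : Euc n → Matrix (Fin n) (Fin n) ℝ) : Prop where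
  dim : 3 ≤ n
  isOpen : IsOpen Ω
  cptObstacle : IsCompact Ωᶜ
  symm : ∀ x, (a x).IsSymm
  posdef : ∀ x, (a x).PosDef
  smooth : ∀ j k, ContDiff ℝ 3 fun y => a y j k
  star : StarshapedC1 Ω a

/-- membership in `H²(Ω) ∩ H¹₀(Ω)` (with a classical-regularity representative). -/
def MemH2H10 (Ω : Set (Euc n)) (v : Euc n → ℂ) : Prop :=
  ContDiffOn ℝ 2 v Ω ∧ (∀ x ∈ frontier Ω, v x = 0) ∧
    IntegrableOn (fun x => ‖v x‖ ^ 2) Ω volume ∧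
    IntegrableOn (fun x => ∑ j, Complex.normSq (pdC j v x)) Ω volume ∧
    IntegrableOn (fun x => ∑ j, ∑ k, Complex.normSq (pdC j (pdC k v) x)) Ω volume

/-- the quantity
`G = |a−I|(|x|²|c_I| + |x|³|∇c_I|) + |x|²(c_{I,−} + [∂_r(|x|c_I)]₊ + c_{II,−})`. -/
def Gfun (a : Euc n → Matrix (Fin n) (Fin n) ℝ) (cI cII : Euc n → ℝ) (x : Euc n) : ℝ :=
  matNorm (a x - 1) * (‖x‖ ^ 2 * |cI x| + ‖x‖ ^ 3 * gradRNorm cI x) +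
    ‖x‖ ^ 2 * (neg (cI x) + pos (radD (fun y => ‖y‖ * cI y) x) + neg (cII x))

/-- Assumption (A₀) of the paper. -/
structure A0 (n : ℕ) (Ω : Set (Euc n)) (a : Euc n → Matrix (Fin n) (Fin n) ℝ)
    (b bI bII : Euc n → Fin n → ℝ) (c cI cII : Euc n → ℝ) (μ : ℝ) : Prop where
  hμ : 0 ≤ μ
  hCa : ∀ x ∈ Ω, Ca a x ≤ μ
  ha1 : l1Linf Ω (fun x => ‖x‖ * aD1 a x) ≤ μ
  hb' : MemWeakLp Ω (bD1 b) n
  hb2 : MemWeakLp Ω (fun x => ∑ j, (b x j) ^ 2) n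
  hbreg : ∀ j, ContDiff ℝ 1 fun y => b y j
  hbsplit : ∀ x, b x = bI x + bII x
  hb3 : n = 3 → bII = 0
  hbμ : l1Linf Ω (fun x => ‖x‖ ^ 2 * rvnorm (dbHat a bI x)) +
      l1Linf Ω (fun x => ‖x‖ ^ 2 * matNorm (a x - 1) * rvnorm (dbHat a bII x)) +
      supNorm Ω (fun x => ‖x‖ ^ 2 * rvnorm (dbHat a bII x)) ≤ μ
  hcsplit : ∀ x, c x = cI x + cII x
  hcIreg : ContDiff ℝ 1 cI
  hcII : l1Linf Ω (fun x => ‖x‖ ^ 2 * (jap x)⁻¹ * |cII x|) ≤ μ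
  hG4 : 4 ≤ n → ∀ x ∈ Ω, Gfun a cI cII x ≤ μ
  hG3 : n = 3 → l1Linf Ω (Gfun a cI cII) ≤ μ

/-- Assumption (A) of the paper. -/
structure AA (n : ℕ) (Ω : Set (Euc n)) (a : Euc n → Matrix (Fin n) (Fin n) ℝ)
    (b bI bII bIII : Euc n → Fin n → ℝ) (c cI cII cIII cIV : Euc n → ℝ)
    (μ Z : ℝ) : Prop where
  hμ : 0 ≤ μ
  hZ : 0 ≤ Z
  hCa : ∀ x ∈ Ω, Ca a x ≤ μ
  ha1 : l1Linf Ω (fun x => ‖x‖ * aD1 a x) ≤ μ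
  hb' : MemWeakLp Ω (bD1 b) n
  hb2 : MemWeakLp Ω (fun x => ∑ j, (b x j) ^ 2) n
  hbreg : ∀ j, ContDiff ℝ 1 fun y => b y j
  hbsplit : ∀ x, b x = bI x + bII x + bIII x
  hb3 : n = 3 → bII = 0
  hbμ : l1Linf Ω (fun x => ‖x‖ ^ 2 * rvnorm (dbHat a bI x)) +
      l1Linf Ω (fun x => ‖x‖ ^ 2 * matNorm (a x - 1) * rvnorm (dbHat a bII x)) +
      supNorm Ω (fun x => ‖x‖ ^ 2 * rvnorm (dbHat a bII x)) ≤ μ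
  hcsplit : ∀ x, c x = cI x + cII x + cIII x + cIV x
  hcIreg : ContDiff ℝ 1 cI
  hcIIIreg : ContDiff ℝ 1 cIII
  hcII : l1Linf Ω (fun x => ‖x‖ ^ 2 * (jap x)⁻¹ * |cII x|) ≤ μ
  hG4 : 4 ≤ n → ∀ x ∈ Ω, Gfun a cI cII x ≤ μ
  hG3 : n = 3 → l1Linf Ω (Gfun a cI cII) ≤ μ
  hbIII : l1Linf Ω (fun x => ‖x‖ * rvnorm (dbHat a bIII x)) ≤ Z
  hcIV : l1Linf Ω (fun x => ‖x‖ * (jap x)⁻¹ * |cIV x|) ≤ Z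
  hcIII : l1Linf Ω (fun x => matNorm (a x - 1) * (|cIII x| + ‖x‖ * gradRNorm cIII x) +
      ‖x‖ ^ 2 * (neg (cIII x) + pos (radD (fun y => ‖y‖ * cIII y) x))) ≤ Z

/-- the weight `ψ = |x|²/(2R)` for `|x| ≤ R`, `= |x|` for `|x| > R`. -/
def ψw (R : ℝ) (x : Euc n) : ℝ := if ‖x‖ ≤ R then ‖x‖ ^ 2 / (2 * R) else ‖x‖

/-- `â = a x̂ ⋅ x̂`. -/
def ahat (a : Euc n → Matrix (Fin n) (Fin n) ℝ) (x : Euc n) : ℝ :=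
  ∑ l, ∑ m, a x l m * xhat x l * xhat x m

/-- the weight `φ = −(â/R) 1_{|x|≤R}`. -/
def φw (a : Euc n → Matrix (Fin n) (Fin n) ℝ) (R : ℝ) (x : Euc n) : ℝ :=
  if ‖x‖ ≤ R then -(ahat a x) / R else 0

/-- the left-hand side of the smoothing estimate:
`‖v‖_Ẋ + (|λ|+|ε|)^{1/2}‖v‖_Ẏ + ‖∇ᵇv‖_Ẏ + ‖(a∇ᵇv)_T‖_{L²} + (n−3)‖|x|^{-3/2}v‖_{L²}`. -/
def SmooLHS (Ω : Set (Euc n)) (a : Euc n → Matrix (Fin n) (Fin n) ℝ)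
    (b : Euc n → Fin n → ℝ) (lam eps : ℝ) (v : Euc n → ℂ) : ℝ :=
  Xnorm Ω v + Real.sqrt (|lam| + |eps|) * Ynorm Ω v + YnormG Ω b v +
    Real.sqrt (∫ x in Ω, vnormSq (tang x (aGradB a b v x))) +
    ((n : ℝ) - 3) * Real.sqrt (∫ x in Ω, ‖x‖ ^ (-(3 : ℝ)) * ‖v x‖ ^ 2)


/-! ### The Morawetz multiplier identities (Theorem 2.2 of the paper) -/

section Morawetz

variable {n : ℕ}

/-- the multiplier `[Aᵇ, ψ] v̄ = (Aψ) v̄ + 2 a(∇ψ, ∇ᵇv)`. -/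
def commB (a : Euc n → Matrix (Fin n) (Fin n) ℝ) (b : Euc n → Fin n → ℝ)
    (ψ : Euc n → ℝ) (v : Euc n → ℂ) (y : Euc n) : ℂ :=
  ((AopR a ψ y : ℝ) : ℂ) * conj (v y) +
    2 * aF a y (fun k => (pdR k ψ y : ℂ)) (gradB b v y)

/-- `I_f = Re[(Aψ + φ) v̄ f + 2 a(∇ψ, ∇ᵇv) f]`. -/
def If' (a : Euc n → Matrix (Fin n) (Fin n) ℝ) (b : Euc n → Fin n → ℝ)
    (ψ φ : Euc n → ℝ) (v f : Euc n → ℂ) (x : Euc n) : ℝ :=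
  (((AopR a ψ x + φ x : ℝ) : ℂ) * conj (v x) * f x +
    2 * aF a x (fun k => (pdR k ψ x : ℂ)) (gradB b v x) * f x).re

/-- `α_{ℓm} = 2 a_{jm} ∂ⱼ(a_{ℓk}∂ₖψ) − a_{jk}∂ₖψ ∂ⱼ a_{ℓm}`. -/
def alphLM (a : Euc n → Matrix (Fin n) (Fin n) ℝ) (ψ : Euc n → ℝ)
    (x : Euc n) (l m : Fin n) : ℝ :=
  2 * ∑ j, a x j m * pdR j (fun y => ∑ k, a y l k * pdR k ψ y) x -
    ∑ j, ∑ k, a x j k * pdR k ψ x * pdR j (fun y => a y l m) x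

/-- `I_{∇v} = α_{ℓm} Re(∂ₘᵇv ∂ₗᵇv̄) + a(∇ᵇv, ∇ᵇv) φ`. -/
def Inv' (a : Euc n → Matrix (Fin n) (Fin n) ℝ) (b : Euc n → Fin n → ℝ)
    (ψ φ : Euc n → ℝ) (v : Euc n → ℂ) (x : Euc n) : ℝ :=
  (∑ l, ∑ m, alphLM a ψ x l m * (pdB b m v x * conj (pdB b l v x)).re) +
    (aF a x (gradB b v x) (gradB b v x)).re * φ x

/-- `I_v = −½ A(Aψ + φ)|v|² − [a(∇ψ, ∇c) − cφ + λφ]|v|²`. -/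
def Iv' (a : Euc n → Matrix (Fin n) (Fin n) ℝ) (c ψ φ : Euc n → ℝ)
    (lam : ℝ) (v : Euc n → ℂ) (x : Euc n) : ℝ :=
  -(1 / 2) * AopR a (fun y => AopR a ψ y + φ y) x * ‖v x‖ ^ 2 -
    ((∑ j, ∑ k, a x j k * pdR k ψ x * pdR j c x) - c x * φ x + lam * φ x) * ‖v x‖ ^ 2

/-- `I_ε = 2ε Im[a(∇ψ, ∇ᵇv) v]`. -/
def Ieps' (a : Euc n → Matrix (Fin n) (Fin n) ℝ) (b : Euc n → Fin n → ℝ)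
    (ψ : Euc n → ℝ) (eps : ℝ) (v : Euc n → ℂ) (x : Euc n) : ℝ :=
  2 * eps * (aF a x (fun k => (pdR k ψ x : ℂ)) (gradB b v x) * v x).im

/-- `I_b = 2 Im[a_{jk}∂ₖᵇv (∂ⱼbₗ − ∂ₗbⱼ) a_{ℓm} ∂ₘψ v̄]`. -/
def Ib' (a : Euc n → Matrix (Fin n) (Fin n) ℝ) (b : Euc n → Fin n → ℝ)
    (ψ : Euc n → ℝ) (v : Euc n → ℂ) (x : Euc n) : ℝ :=
  2 * (∑ j, ∑ k, ∑ l, ∑ m,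
      (a x j k : ℂ) * pdB b k v x * (dbM b x j l : ℂ) * (a x l m : ℂ) *
        (pdR m ψ x : ℂ) * conj (v x)).im

/-- `Qⱼ = a_{jk}∂ₖᵇv · [Aᵇ,ψ]v̄ − ½ a_{jk}(∂ₖAψ)|v|² − a_{jk}∂ₖψ[(c−λ)|v|² + a(∇ᵇv,∇ᵇv)]`. -/
def Qf (a : Euc n → Matrix (Fin n) (Fin n) ℝ) (b : Euc n → Fin n → ℝ)
    (c ψ : Euc n → ℝ) (lam : ℝ) (v : Euc n → ℂ) (j : Fin n) (y : Euc n) : ℂ :=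
  (∑ k, (a y j k : ℂ) * pdB b k v y) * commB a b ψ v y -
    (1 / 2) * ((∑ k, a y j k * pdR k (AopR a ψ) y : ℝ) : ℂ) * ((‖v y‖ ^ 2 : ℝ) : ℂ) -
    ((∑ k, a y j k * pdR k ψ y : ℝ) : ℂ) *
      (((c y - lam : ℝ) : ℂ) * ((‖v y‖ ^ 2 : ℝ) : ℂ) +
        aF a y (gradB b v y) (gradB b v y))

/-- `Pⱼ = a_{jk}∂ₖᵇv φ v̄ − ½ a_{jk}∂ₖφ |v|²`. -/
def Pf (a : Euc n → Matrix (Fin n) (Fin n) ℝ) (b : Euc n → Fin n → ℝ)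
    (φ : Euc n → ℝ) (v : Euc n → ℂ) (j : Fin n) (y : Euc n) : ℂ :=
  (∑ k, (a y j k : ℂ) * pdB b k v y) * ((φ y : ℝ) : ℂ) * conj (v y) -
    (1 / 2) * ((∑ k, a y j k * pdR k φ y : ℝ) : ℂ) * ((‖v y‖ ^ 2 : ℝ) : ℂ)

/-- `w` is differentiable at `x` and its `j`-th partial derivative there is `w'`. -/
def HasPdC (j : Fin n) (w : Euc n → ℂ) (w' : ℂ) (x : Euc n) : Prop :=
  DifferentiableAt ℝ w x ∧ pdC j w x = w'

namespace HasPdC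

variable {j : Fin n} {w z : Euc n → ℂ} {w' z' : ℂ} {x : Euc n}

lemma of_differentiableAt (hw : DifferentiableAt ℝ w x) : HasPdC j w (pdC j w x) x :=
  ⟨hw, rfl⟩

lemma const (r : ℂ) : HasPdC j (fun _ => r) 0 x :=
  ⟨differentiableAt_const r, by simp [pdC]⟩

lemma add (hw : HasPdC j w w' x) (hz : HasPdC j z z' x) :
    HasPdC j (fun y => w y + z y) (w' + z') x :=
  ⟨hw.1.add hz.1, by rw [← hw.2, ← hz.2]; simp [pdC, fderiv_fun_add hw.1 hz.1]⟩

lemma sub (hw : HasPdC j w w' x) (hz : HasPdC j z z' x) :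
    HasPdC j (fun y => w y - z y) (w' - z') x :=
  ⟨hw.1.sub hz.1, by rw [← hw.2, ← hz.2]; simp [pdC, fderiv_fun_sub hw.1 hz.1]⟩

lemma mul (hw : HasPdC j w w' x) (hz : HasPdC j z z' x) :
    HasPdC j (fun y => w y * z y) (w' * z x + w x * z') x :=
  ⟨hw.1.mul hz.1, by
    rw [← hw.2, ← hz.2]
    simp [pdC, fderiv_fun_mul hw.1 hz.1]
    ring⟩

lemma const_mul (r : ℂ) (hw : HasPdC j w w' x) : HasPdC j (fun y => r * w y) (r * w') x := by
  simpa using (const r).mul hw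

lemma sum {ι : Type*} {s : Finset ι} {u : ι → Euc n → ℂ} {u' : ι → ℂ}
    (hu : ∀ i ∈ s, HasPdC j (u i) (u' i) x) :
    HasPdC j (fun y => ∑ i ∈ s, u i y) (∑ i ∈ s, u' i) x := by
  have hd : ∀ i ∈ s, DifferentiableAt ℝ (u i) x := fun i hi => (hu i hi).1
  refine ⟨DifferentiableAt.fun_sum hd, ?_⟩
  rw [← Finset.sum_congr rfl fun i hi => (hu i hi).2]
  simp [pdC, fderiv_fun_sum hd]

lemma ofReal {g : Euc n → ℝ} (hg : DifferentiableAt ℝ g x) :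
    HasPdC j (fun y => (g y : ℂ)) (pdR j g x : ℂ) x := by
  have h := (Complex.ofRealCLM.hasFDerivAt (x := g x)).comp x hg.hasFDerivAt
  have h' : fderiv ℝ (fun y => (g y : ℂ)) x = Complex.ofRealCLM.comp (fderiv ℝ g x) := h.fderiv
  exact ⟨h.differentiableAt, by simp [pdC, pdR, h']⟩

lemma conjugate (hw : HasPdC j w w' x) :
    HasPdC j (fun y => conj (w y)) (starRingEnd ℂ w') x := by
  have h := (Complex.conjCLE.hasFDerivAt (x := w x)).comp x hw.1.hasFDerivAt
  have h' : fderiv ℝ (fun y => starRingEnd ℂ (w y)) x =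
      (Complex.conjCLE : ℂ →L[ℝ] ℂ).comp (fderiv ℝ w x) := h.fderiv
  exact ⟨h.differentiableAt, by rw [← hw.2]; simp [pdC, h']⟩

end HasPdC

lemma pdR_add {g h : Euc n → ℝ} {x : Euc n} (hg : DifferentiableAt ℝ g x)
    (hh : DifferentiableAt ℝ h x) (j : Fin n) :
    pdR j (fun y => g y + h y) x = pdR j g x + pdR j h x := by
  simp [pdR, fderiv_fun_add hg hh]

lemma contDiff_pdR {m k : WithTop ℕ∞} {g : Euc n → ℝ} (hg : ContDiff ℝ m g)
    (hk : k + 1 ≤ m) (j : Fin n) : ContDiff ℝ k (pdR j g) :=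
  (hg.fderiv_right hk).clm_apply contDiff_const

lemma contDiffAt_pdC {m k : WithTop ℕ∞} {w : Euc n → ℂ} {x : Euc n}
    (hw : ContDiffAt ℝ m w x) (hk : k + 1 ≤ m) (j : Fin n) : ContDiffAt ℝ k (pdC j w) x :=
  (hw.fderiv_right hk).clm_apply contDiffAt_const

lemma pdC_comm {w : Euc n → ℂ} {x : Euc n} (hw : ContDiffAt ℝ 2 w x) (j k : Fin n) :
    pdC j (pdC k w) x = pdC k (pdC j w) x := by
  have hd : DifferentiableAt ℝ (fderiv ℝ w) x :=
    (hw.fderiv_right (m := 1) (by norm_num)).differentiableAt (by norm_num)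
  have key : ∀ i l : Fin n, pdC i (pdC l w) x =
      fderiv ℝ (fderiv ℝ w) x (EuclideanSpace.single i 1) (EuclideanSpace.single l 1) := by
    intro i l
    have : fderiv ℝ (pdC l w) x = _ :=
      (hd.hasFDerivAt.clm_apply (hasFDerivAt_const (EuclideanSpace.single l (1 : ℝ)) x)).fderiv
    rw [pdC, this]
    simp
  rw [key, key]
  exact hw.isSymmSndFDerivAt (by simp) _ _

/-- the vector `a ∇ψ` for a real weight `ψ`. -/
def aGradR (a : Euc n → Matrix (Fin n) (Fin n) ℝ) (ψ : Euc n → ℝ) (j : Fin n)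
    (y : Euc n) : ℝ :=
  ∑ k, a y j k * pdR k ψ y

lemma contDiff_aGradR {m k : WithTop ℕ∞} {a : Euc n → Matrix (Fin n) (Fin n) ℝ}
    {ψ : Euc n → ℝ} (ha : ∀ j l, ContDiff ℝ m fun y => a y j l) (hψ : ContDiff ℝ k ψ)
    (hk : m + 1 ≤ k) (j : Fin n) : ContDiff ℝ m (aGradR a ψ j) :=
  ContDiff.sum fun i _ => (ha j i).mul (contDiff_pdR hψ hk i)

lemma contDiff_AopR {m k l : WithTop ℕ∞} {a : Euc n → Matrix (Fin n) (Fin n) ℝ}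
    {ψ : Euc n → ℝ} (ha : ∀ i j, ContDiff ℝ k fun y => a y i j) (hψ : ContDiff ℝ l ψ)
    (hk : k + 1 ≤ l) (hm : m + 1 ≤ k) : ContDiff ℝ m (AopR a ψ) :=
  ContDiff.sum fun j _ => contDiff_pdR (contDiff_aGradR ha hψ hk j) hm j

lemma AopR_add {a : Euc n → Matrix (Fin n) (Fin n) ℝ} {g h : Euc n → ℝ}
    (ha : ∀ j k, ContDiff ℝ 1 fun y => a y j k) (hg : ContDiff ℝ 2 g) (hh : ContDiff ℝ 2 h)
    (x : Euc n) : AopR a (fun y => g y + h y) x = AopR a g x + AopR a h x := by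
  have e : ∀ j, (fun y => ∑ k, a y j k * pdR k (fun z => g z + h z) y) =
      fun y => aGradR a g j y + aGradR a h j y := by
    intro j
    funext y
    simp only [aGradR, ← Finset.sum_add_distrib]
    refine Finset.sum_congr rfl fun k _ => ?_
    rw [pdR_add (hg.differentiable (by norm_num) y) (hh.differentiable (by norm_num) y)]
    ring
  simp only [AopR, e, ← Finset.sum_add_distrib]
  refine Finset.sum_congr rfl fun j _ => ?_
  exact pdR_add
    ((contDiff_aGradR ha hg (by norm_num) j).differentiable (by norm_num) x)
    ((contDiff_aGradR ha hh (by norm_num) j).differentiable (by norm_num) x) j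

lemma contDiffAt_pdB {b : Euc n → Fin n → ℝ} (hb : ∀ j, ContDiff ℝ 1 fun y => b y j)
    {v : Euc n → ℂ} {x : Euc n} (hv : ContDiffAt ℝ 2 v x) (j : Fin n) :
    ContDiffAt ℝ 1 (pdB b j v) x := by
  have h1 : ContDiffAt ℝ 1 (fun y => (b y j : ℂ)) x :=
    Complex.ofRealCLM.contDiff.contDiffAt.comp x (hb j).contDiffAt
  exact (contDiffAt_pdC hv (by norm_num) j).add
    ((contDiffAt_const.mul h1).mul (hv.of_le (by norm_num)))

lemma pdB_comm {b : Euc n → Fin n → ℝ} (hb : ∀ j, ContDiff ℝ 1 fun y => b y j)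
    {v : Euc n → ℂ} {x : Euc n} (hv : ContDiffAt ℝ 2 v x) (j l : Fin n) :
    pdB b j (pdB b l v) x = pdB b l (pdB b j v) x + Complex.I * (dbM b x j l : ℂ) * v x := by
  have key : ∀ i m : Fin n, pdC i (pdB b m v) x = pdC i (pdC m v) x +
      Complex.I * ((pdR i (fun y => b y m) x : ℂ) * v x + (b x m : ℂ) * pdC i v x) := by
    intro i m
    have e : pdB b m v = fun y => pdC m v y + Complex.I * ((b y m : ℂ) * v y) := by
      funext y
      simp [pdB, mul_assoc]
    have hv' : HasPdC i v _ x := .of_differentiableAt (hv.differentiableAt (by norm_num))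
    have hv'' : HasPdC i (pdC m v) _ x := .of_differentiableAt
      ((contDiffAt_pdC (k := 1) hv (by norm_num) m).differentiableAt (by norm_num))
    have hB : HasPdC i (fun y => (b y m : ℂ)) _ x :=
      .ofReal ((hb m).differentiable (by norm_num) x)
    rw [e, (hv''.add ((hB.mul hv').const_mul _)).2]
  have e1 : ∀ i m : Fin n, pdB b i (pdB b m v) x =
      pdC i (pdB b m v) x + Complex.I * (b x i : ℂ) * pdB b m v x := fun _ _ => rfl
  have e2 : (dbM b x j l : ℂ) =
      (pdR j (fun y => b y l) x : ℂ) - (pdR l (fun y => b y j) x : ℂ) := by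
    rw [← Complex.ofReal_sub]
    rfl
  rw [e1, e1, key, key, pdC_comm hv j l, e2]
  simp only [pdB]
  ring

lemma ofReal_norm_sq (z : ℂ) : ((‖z‖ ^ 2 : ℝ) : ℂ) = z * conj z := by
  rw [Complex.mul_conj, Complex.normSq_eq_norm_sq]

lemma hasPdC_norm_sq (b : Euc n → Fin n → ℝ) {v : Euc n → ℂ} {x : Euc n}
    (hv : DifferentiableAt ℝ v x) (j : Fin n) :
    HasPdC j (fun y => v y * conj (v y))
      (pdB b j v x * conj (v x) + v x * conj (pdB b j v x)) x := by
  have h := (HasPdC.of_differentiableAt (j := j) hv).mul (HasPdC.of_differentiableAt hv).conjugate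
  refine ⟨h.1, h.2.trans ?_⟩
  simp only [pdB, map_add, map_mul, Complex.conj_I, Complex.conj_ofReal]
  ring

lemma sum_symm_pairing {a : Matrix (Fin n) (Fin n) ℝ} (hs : a.IsSymm) (p q : Fin n → ℂ) :
    ∑ j, (∑ k, (a j k : ℂ) * p k) * q j = ∑ j, (∑ k, (a j k : ℂ) * q k) * p j := by
  simp only [Finset.sum_mul]
  rw [Finset.sum_comm]
  refine Finset.sum_congr rfl fun j _ => Finset.sum_congr rfl fun k _ => ?_
  rw [hs.apply j k]
  ring

lemma sum_aGradR_mul_pdB {a : Euc n → Matrix (Fin n) (Fin n) ℝ} {x : Euc n}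
    (hs : (a x).IsSymm) (b : Euc n → Fin n → ℝ) (g : Euc n → ℝ) (v : Euc n → ℂ) :
    ∑ j, (aGradR a g j x : ℂ) * pdB b j v x = ∑ j, aGradB a b v x j * (pdR j g x : ℂ) := by
  simpa [aGradR, aGradB] using
    sum_symm_pairing hs (fun k => (pdR k g x : ℂ)) (fun k => pdB b k v x)

lemma aF_gradB_eq (a : Euc n → Matrix (Fin n) (Fin n) ℝ) (b : Euc n → Fin n → ℝ)
    (v : Euc n → ℂ) (z : Fin n → ℂ) (y : Euc n) :
    aF a y (gradB b v y) z = ∑ j, aGradB a b v y j * conj (z j) := by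
  simp only [aF, gradB, aGradB, Finset.sum_mul]

lemma aF_gradR_eq (a : Euc n → Matrix (Fin n) (Fin n) ℝ) (ψ : Euc n → ℝ) (z : Fin n → ℂ)
    (y : Euc n) :
    aF a y (fun k => (pdR k ψ y : ℂ)) z = ∑ j, (aGradR a ψ j y : ℂ) * conj (z j) := by
  simp only [aF, aGradR]
  push_cast
  simp only [Finset.sum_mul]

lemma sum_pdR_aGradR (a : Euc n → Matrix (Fin n) (Fin n) ℝ) (g : Euc n → ℝ) (x : Euc n) :
    ∑ j, (pdR j (aGradR a g j) x : ℂ) = (AopR a g x : ℂ) := by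
  rw [← Complex.ofReal_sum]
  rfl

lemma hasPdC_Pf {a : Euc n → Matrix (Fin n) (Fin n) ℝ} {x : Euc n}
    (ha : ∀ j k, ContDiff ℝ 1 fun y => a y j k)
    {b : Euc n → Fin n → ℝ} {φ : Euc n → ℝ} (hφ : ContDiff ℝ 2 φ) {v : Euc n → ℂ}
    (hv : DifferentiableAt ℝ v x) {j : Fin n}
    (hV : DifferentiableAt ℝ (fun y => aGradB a b v y j) x) :
    HasPdC j (Pf a b φ v j)
      (pdB b j (fun y => aGradB a b v y j) x * conj (v x) * (φ x : ℂ)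
      + aGradB a b v x j * conj (pdB b j v x) * (φ x : ℂ)
      + aGradB a b v x j * conj (v x) * (pdR j φ x : ℂ)
      - (1 / 2) * (pdR j (aGradR a φ j) x : ℂ) * (v x * conj (v x))
      - (1 / 2) * ((aGradR a φ j x : ℂ) *
        (pdB b j v x * conj (v x) + v x * conj (pdB b j v x)))) x := by
  have hv' := HasPdC.of_differentiableAt (j := j) hv
  have hφ' := HasPdC.ofReal (j := j) (hφ.differentiable (by norm_num) x)
  have hg' := HasPdC.ofReal (j := j)
    ((contDiff_aGradR ha hφ (by norm_num) j).differentiable (by norm_num) x)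
  have hV' := HasPdC.of_differentiableAt (j := j) hV
  have e : Pf a b φ v j = fun y => (aGradB a b v y j * (φ y : ℂ)) * conj (v y) -
      (1 / 2) * ((aGradR a φ j y : ℂ) * (v y * conj (v y))) := by
    funext y
    simp only [Pf, aGradB, aGradR, ofReal_norm_sq, mul_assoc]
  have h := ((hV'.mul hφ').mul hv'.conjugate).sub ((hg'.mul (hasPdC_norm_sq b hv j)).const_mul (1 / 2))
  rw [e]
  refine ⟨h.1, h.2.trans ?_⟩
  simp only [pdB, map_add, map_mul, Complex.conj_I, Complex.conj_ofReal]
  ring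

lemma sum_pdC_Pf {a : Euc n → Matrix (Fin n) (Fin n) ℝ} {x : Euc n} (hs : (a x).IsSymm)
    (ha : ∀ j k, ContDiff ℝ 1 fun y => a y j k)
    {b : Euc n → Fin n → ℝ} {φ : Euc n → ℝ} (hφ : ContDiff ℝ 2 φ) {v : Euc n → ℂ}
    (hv : DifferentiableAt ℝ v x)
    (hV : ∀ j, DifferentiableAt ℝ (fun y => aGradB a b v y j) x) :
    ∑ j, pdC j (Pf a b φ v j) x =
      aF a x (gradB b v x) (gradB b v x) * (φ x : ℂ) + Aop a b v x * conj (v x) * (φ x : ℂ) -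
        (1 / 2) * (AopR a φ x : ℂ) * ((‖v x‖ ^ 2 : ℝ) : ℂ) +
        Complex.I *
          ((aF a x (gradB b v x) (fun j => v x * (pdR j φ x : ℂ))).im : ℂ) := by
  have hX := sum_aGradR_mul_pdB hs b φ v
  have hX' := congrArg conj hX
  simp only [map_sum, map_mul, Complex.conj_ofReal] at hX'
  have hI : Complex.I * ((aF a x (gradB b v x) (fun j => v x * (pdR j φ x : ℂ))).im : ℂ) =
      (1 / 2) * (conj (v x) * ∑ j, aGradB a b v x j * (pdR j φ x : ℂ) -
        v x * ∑ j, conj (aGradB a b v x j) * (pdR j φ x : ℂ)) := by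
    have h1 : aF a x (gradB b v x) (fun j => v x * (pdR j φ x : ℂ)) =
        conj (v x) * ∑ j, aGradB a b v x j * (pdR j φ x : ℂ) := by
      rw [aF_gradB_eq, Finset.mul_sum]
      refine Finset.sum_congr rfl fun j _ => ?_
      simp only [map_mul, Complex.conj_ofReal]
      ring
    rw [h1, Complex.im_eq_sub_conj]
    simp only [map_sum, map_mul, Complex.conj_ofReal, Complex.conj_conj]
    field_simp
  have hA : ∑ j, pdB b j (fun y => aGradB a b v y j) x = Aop a b v x := rfl
  rw [Finset.sum_congr rfl fun j _ => (hasPdC_Pf ha hφ hv (hV j)).2, hI, aF_gradB_eq,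
    ofReal_norm_sq, ← hA, ← sum_pdR_aGradR]
  simp only [gradB]
  linear_combination (norm := skip) -(1 / 2) * conj (v x) * hX - (1 / 2) * v x * hX'
  simp only [Finset.mul_sum, Finset.sum_mul, ← Finset.sum_add_distrib, ← Finset.sum_sub_distrib]
  exact Finset.sum_eq_zero fun j _ => by ring

lemma hasPdC_Qf {a : Euc n → Matrix (Fin n) (Fin n) ℝ} {x : Euc n}
    (ha : ∀ j k, ContDiff ℝ 3 fun y => a y j k)
    {b : Euc n → Fin n → ℝ} (hb : ∀ j, ContDiff ℝ 1 fun y => b y j)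
    {c ψ : Euc n → ℝ} (hc : DifferentiableAt ℝ c x) (hψ : ContDiff ℝ 4 ψ) {lam : ℝ}
    {v : Euc n → ℂ} (hv : ContDiffAt ℝ 2 v x) {j : Fin n}
    (hV : ∀ l, DifferentiableAt ℝ (fun y => aGradB a b v y l) x) :
    HasPdC j (Qf a b c ψ lam v j)
      (pdB b j (fun y => aGradB a b v y j) x * commB a b ψ v x
      + aGradB a b v x j * ((pdR j (AopR a ψ) x : ℂ) * conj (v x)
        + (AopR a ψ x : ℂ) * conj (pdB b j v x)
        + 2 * ∑ l, (pdR j (aGradR a ψ l) x : ℂ) * conj (pdB b l v x)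
        + 2 * (∑ l, (aGradR a ψ l x : ℂ) * conj (pdB b l (pdB b j v) x)
          - Complex.I * conj (v x) * ∑ l, (dbM b x j l : ℂ) * (aGradR a ψ l x : ℂ)))
      - (1 / 2) * ((pdR j (aGradR a (AopR a ψ) j) x : ℂ) * (v x * conj (v x))
        + (aGradR a (AopR a ψ) j x : ℂ) *
          (pdB b j v x * conj (v x) + v x * conj (pdB b j v x)))
      - (pdR j (aGradR a ψ j) x : ℂ) * (((c x - lam : ℝ) : ℂ) * (v x * conj (v x))
        + aF a x (gradB b v x) (gradB b v x))
      - (aGradR a ψ j x : ℂ) * ((pdR j c x : ℂ) * (v x * conj (v x))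
        + ((c x - lam : ℝ) : ℂ) * (pdB b j v x * conj (v x) + v x * conj (pdB b j v x))
        + ∑ l, ∑ m, (pdR j (fun y => a y l m) x : ℂ) * (pdB b m v x * conj (pdB b l v x))
        + ∑ l, (∑ m, (a x l m : ℂ) * pdB b j (pdB b m v) x) * conj (pdB b l v x)
        + ∑ l, aGradB a b v x l * conj (pdB b j (pdB b l v) x))) x := by
  have hvd : DifferentiableAt ℝ v x := hv.differentiableAt (by norm_num)
  have hv' := HasPdC.of_differentiableAt (j := j) hvd
  have hc' := HasPdC.ofReal (j := j) hc
  have hD' := fun l => HasPdC.of_differentiableAt (j := j)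
    ((contDiffAt_pdB hb hv l).differentiableAt (by norm_num))
  have ha' := fun l m => HasPdC.ofReal (j := j) ((ha l m).differentiable (by norm_num) x)
  have hg := fun l => contDiff_aGradR ha hψ (by norm_num) l
  have hg' := fun l => HasPdC.ofReal (j := j) ((hg l).differentiable (by norm_num) x)
  have hG : ContDiff ℝ 2 (AopR a ψ) := contDiff_AopR ha hψ (by norm_num) (by norm_num)
  have hG' := HasPdC.ofReal (j := j) (hG.differentiable (by norm_num) x)
  have hh' := HasPdC.ofReal (j := j) ((contDiff_aGradR (m := 1)
    (fun l m => (ha l m).of_le (by norm_num)) hG (by norm_num) j).differentiable (by norm_num) x)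
  have hV' := HasPdC.of_differentiableAt (j := j) (hV j)
  have hN' := hasPdC_norm_sq b hvd j
  have eC : commB a b ψ v = fun y => (AopR a ψ y : ℂ) * conj (v y) +
      2 * ∑ l, (aGradR a ψ l y : ℂ) * conj (pdB b l v y) := by
    funext y
    simp only [commB, aF_gradR_eq, gradB]
  have hC := (hG'.mul hv'.conjugate).add ((HasPdC.sum (s := Finset.univ)
    fun l _ => (hg' l).mul (hD' l).conjugate).const_mul 2)
  have hC' : HasPdC j (commB a b ψ v) (Complex.I * (b x j : ℂ) * commB a b ψ v x +
      ((pdR j (AopR a ψ) x : ℂ) * conj (v x)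
        + (AopR a ψ x : ℂ) * conj (pdB b j v x)
        + 2 * ∑ l, (pdR j (aGradR a ψ l) x : ℂ) * conj (pdB b l v x)
        + 2 * (∑ l, (aGradR a ψ l x : ℂ) * conj (pdB b l (pdB b j v) x)
          - Complex.I * conj (v x) * ∑ l, (dbM b x j l : ℂ) * (aGradR a ψ l x : ℂ)))) x := by
    rw [eC]
    refine ⟨hC.1, hC.2.trans ?_⟩
    have hK : ∀ l, conj (pdC j (pdB b l v) x) = conj (pdB b l (pdB b j v) x)
        - Complex.I * (dbM b x j l : ℂ) * conj (v x)
        + Complex.I * (b x j : ℂ) * conj (pdB b l v x) := by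
      intro l
      have h := congrArg conj (pdB_comm hb hv j l)
      rw [show pdB b j (pdB b l v) x = pdC j (pdB b l v) x +
        Complex.I * (b x j : ℂ) * pdB b l v x from rfl] at h
      simp only [map_add, map_mul, Complex.conj_I, Complex.conj_ofReal] at h
      linear_combination h
    have hKv : conj (pdC j v x) = conj (pdB b j v x) + Complex.I * (b x j : ℂ) * conj (v x) := by
      simp only [pdB, map_add, map_mul, Complex.conj_I, Complex.conj_ofReal]
      ring
    simp only [hK, hKv]
    rw [← sub_eq_zero]
    have h0 : ∑ l, (2 * ((pdR j (aGradR a ψ l) x : ℂ) * conj (pdB b l v x) +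
        (aGradR a ψ l x : ℂ) * (conj (pdB b l (pdB b j v) x)
        - Complex.I * (dbM b x j l : ℂ) * conj (v x)
        + Complex.I * (b x j : ℂ) * conj (pdB b l v x)))
        - Complex.I * (b x j : ℂ) * (2 * ((aGradR a ψ l x : ℂ) * conj (pdB b l v x)))
        - 2 * ((pdR j (aGradR a ψ l) x : ℂ) * conj (pdB b l v x))
        - 2 * ((aGradR a ψ l x : ℂ) * conj (pdB b l (pdB b j v) x)
          - Complex.I * conj (v x) * ((dbM b x j l : ℂ) * (aGradR a ψ l x : ℂ)))) = 0 :=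
      Finset.sum_eq_zero fun l _ => by ring
    simp only [Finset.sum_sub_distrib, ← Finset.mul_sum] at h0
    linear_combination h0
  have eE : (fun y => aF a y (gradB b v y) (gradB b v y)) =
      fun y => ∑ l, ∑ m, (a y l m : ℂ) * (pdB b m v y * conj (pdB b l v y)) := by
    funext y
    simp only [aF, gradB, mul_assoc]
  have hE := HasPdC.sum (s := Finset.univ) fun l _ => HasPdC.sum (s := Finset.univ)
    fun m _ => (ha' l m).mul ((hD' m).mul (hD' l).conjugate)
  have hE' : HasPdC j (fun y => aF a y (gradB b v y) (gradB b v y))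
      (∑ l, ∑ m, (pdR j (fun y => a y l m) x : ℂ) * (pdB b m v x * conj (pdB b l v x))
        + ∑ l, (∑ m, (a x l m : ℂ) * pdB b j (pdB b m v) x) * conj (pdB b l v x)
        + ∑ l, aGradB a b v x l * conj (pdB b j (pdB b l v) x)) x := by
    rw [eE]
    refine ⟨hE.1, hE.2.trans ?_⟩
    have hK : ∀ l, pdC j (pdB b l v) x = pdB b j (pdB b l v) x
        - Complex.I * (b x j : ℂ) * pdB b l v x := by
      intro l
      rw [show pdB b j (pdB b l v) x = pdC j (pdB b l v) x +
        Complex.I * (b x j : ℂ) * pdB b l v x from rfl]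
      ring
    simp only [hK, aGradB, Finset.sum_mul, ← Finset.sum_add_distrib]
    refine Finset.sum_congr rfl fun l _ => Finset.sum_congr rfl fun m _ => ?_
    simp only [map_sub, map_mul, Complex.conj_I, Complex.conj_ofReal]
    ring
  have hcl : HasPdC j (fun y => ((c y - lam : ℝ) : ℂ)) (pdR j c x : ℂ) x := by
    have h := hc'.sub (HasPdC.const (lam : ℂ))
    simpa using h
  have e : Qf a b c ψ lam v j = fun y => aGradB a b v y j * commB a b ψ v y -
      (1 / 2) * ((aGradR a (AopR a ψ) j y : ℂ) * (v y * conj (v y))) -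
      (aGradR a ψ j y : ℂ) * (((c y - lam : ℝ) : ℂ) * (v y * conj (v y)) +
        aF a y (gradB b v y) (gradB b v y)) := by
    funext y
    simp only [Qf, aGradB, aGradR, ofReal_norm_sq, mul_assoc]
  have h := ((hV'.mul hC').sub ((hh'.mul hN').const_mul (1 / 2))).sub
    ((hg' j).mul ((hcl.mul hN').add hE'))
  rw [e]
  refine ⟨h.1, h.2.trans ?_⟩
  rw [show pdB b j (fun y => aGradB a b v y j) x = pdC j (fun y => aGradB a b v y j) x +
    Complex.I * (b x j : ℂ) * aGradB a b v x j from rfl]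
  ring

lemma re_sum_divergence {ι : Type*} [Fintype ι] (V dV D s κ β F Y : ι → ℂ)
    (h dh dG g dg dc : ι → ℝ) (v : ℂ) (cl : ℝ)
    (hU : ∑ j, (h j : ℂ) * D j = ∑ j, V j * (dG j : ℂ))
    (hZ : ∑ j, V j * κ j = ∑ j, (g j : ℂ) * Y j) :
    (∑ j, (dV j * (((∑ i, dg i : ℝ) : ℂ) * conj v + 2 * ∑ i, (g i : ℂ) * conj (D i))
      + V j * ((dG j : ℂ) * conj v + ((∑ i, dg i : ℝ) : ℂ) * conj (D j)
        + 2 * s j + 2 * (κ j - Complex.I * conj v * β j))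
      - (1 / 2) * ((dh j : ℂ) * (v * conj v) + (h j : ℂ) * (D j * conj v + v * conj (D j)))
      - (dg j : ℂ) * ((cl : ℂ) * (v * conj v) + ∑ i, V i * conj (D i))
      - (g j : ℂ) * ((dc j : ℂ) * (v * conj v) + (cl : ℂ) * (D j * conj v + v * conj (D j))
        + F j + conj (Y j) + Y j))).re =
    ((∑ j, dV j) * (((∑ i, dg i : ℝ) : ℂ) * conj v + 2 * ∑ i, (g i : ℂ) * conj (D i))).re
      + 2 * (∑ j, V j * s j).re + 2 * (∑ j, V j * β j * conj v).im
      - (1 / 2) * (∑ j, dh j) * ‖v‖ ^ 2 - (∑ j, dg j) * cl * ‖v‖ ^ 2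
      - (∑ j, g j * dc j) * ‖v‖ ^ 2 - 2 * cl * ((∑ i, (g i : ℂ) * conj (D i)) * v).re
      - (∑ j, (g j : ℂ) * F j).re := by
  have hGc : ((∑ i, dg i : ℝ) : ℂ) = ∑ i, (dg i : ℂ) := by simp
  have hn : v * conj v = ((‖v‖ ^ 2 : ℝ) : ℂ) := (ofReal_norm_sq v).symm
  have hW : ∑ i, (g i : ℂ) * D i = conj (∑ i, (g i : ℂ) * conj (D i)) := by simp
  have hY : ∑ i, (g i : ℂ) * conj (Y i) = conj (∑ i, (g i : ℂ) * Y i) := by simp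
  have hU' : ∑ i, (h i : ℂ) * conj (D i) = conj (∑ j, V j * (dG j : ℂ)) := by simp [← hU]
  have hdh : ((∑ i, dh i : ℝ) : ℂ) = ∑ i, (dh i : ℂ) := by simp
  have hdc : ((∑ i, g i * dc i : ℝ) : ℂ) = ∑ i, (g i : ℂ) * (dc i : ℂ) := by simp
  have split : ∀ G C E : ℂ, ∑ j, (dV j * C
      + V j * ((dG j : ℂ) * conj v + G * conj (D j)
        + 2 * s j + 2 * (κ j - Complex.I * conj v * β j))
      - (1 / 2) * ((dh j : ℂ) * (v * conj v) + (h j : ℂ) * (D j * conj v + v * conj (D j)))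
      - (dg j : ℂ) * ((cl : ℂ) * (v * conj v) + E)
      - (g j : ℂ) * ((dc j : ℂ) * (v * conj v) + (cl : ℂ) * (D j * conj v + v * conj (D j))
        + F j + conj (Y j) + Y j)) =
      (∑ j, dV j) * C + (∑ j, V j * (dG j : ℂ)) * conj v + G * (∑ j, V j * conj (D j))
      + 2 * (∑ j, V j * s j) + 2 * (∑ j, V j * κ j)
      - 2 * Complex.I * (∑ j, V j * β j * conj v)
      - (1 / 2) * (v * conj v) * (∑ j, (dh j : ℂ))
      - (1 / 2) * conj v * (∑ j, (h j : ℂ) * D j) - (1 / 2) * v * (∑ j, (h j : ℂ) * conj (D j))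
      - (cl * (v * conj v) + E) * (∑ j, (dg j : ℂ))
      - (v * conj v) * (∑ j, (g j : ℂ) * (dc j : ℂ))
      - cl * conj v * (∑ j, (g j : ℂ) * D j) - cl * v * (∑ j, (g j : ℂ) * conj (D j))
      - (∑ j, (g j : ℂ) * F j) - (∑ j, (g j : ℂ) * conj (Y j)) - (∑ j, (g j : ℂ) * Y j) := by
    intro G C E
    simp only [Finset.mul_sum, Finset.sum_mul, ← Finset.sum_add_distrib,
      ← Finset.sum_sub_distrib]
    exact Finset.sum_congr rfl fun j _ => by ring
  rw [split, hZ, hU, hU', hW, hY, ← hGc, ← hdh, ← hdc, hn]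
  generalize ∑ i, (g i : ℂ) * conj (D i) = W
  generalize ∑ i, (g i : ℂ) * Y i = Z
  generalize ∑ j, V j * (dG j : ℂ) = U
  generalize ∑ i, dg i = G
  generalize ∑ j, V j * conj (D j) = E
  generalize ∑ j, V j * β j * conj v = B
  simp only [Complex.add_re, Complex.sub_re, Complex.mul_re, Complex.mul_im, Complex.add_im,
    Complex.conj_re, Complex.conj_im, Complex.ofReal_re, Complex.ofReal_im, Complex.I_re,
    Complex.I_im, Complex.re_ofNat, Complex.im_ofNat, Complex.div_ofNat_re,
    Complex.div_ofNat_im, Complex.one_re, Complex.one_im]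
  ring

lemma re_sum_pdC_Qf {a : Euc n → Matrix (Fin n) (Fin n) ℝ} {x : Euc n} (hs : (a x).IsSymm)
    (ha : ∀ j k, ContDiff ℝ 3 fun y => a y j k)
    {b : Euc n → Fin n → ℝ} (hb : ∀ j, ContDiff ℝ 1 fun y => b y j)
    {c ψ : Euc n → ℝ} (hc : DifferentiableAt ℝ c x) (hψ : ContDiff ℝ 4 ψ) {lam : ℝ}
    {v : Euc n → ℂ} (hv : ContDiffAt ℝ 2 v x)
    (hV : ∀ l, DifferentiableAt ℝ (fun y => aGradB a b v y l) x) :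
    (∑ j, pdC j (Qf a b c ψ lam v j) x).re =
      (Aop a b v x * commB a b ψ v x).re
      + (∑ l, ∑ m, alphLM a ψ x l m * (pdB b m v x * conj (pdB b l v x)).re)
      + Ib' a b ψ v x
      - (1 / 2) * AopR a (AopR a ψ) x * ‖v x‖ ^ 2 - AopR a ψ x * (c x - lam) * ‖v x‖ ^ 2
      - (∑ j, ∑ k, a x j k * pdR k ψ x * pdR j c x) * ‖v x‖ ^ 2
      - 2 * (c x - lam) *
        (aF a x (fun k => (pdR k ψ x : ℂ)) (gradB b v x) * v x).re := by
  have hC : commB a b ψ v x = (AopR a ψ x : ℂ) * conj (v x) +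
      2 * ∑ l, (aGradR a ψ l x : ℂ) * conj (pdB b l v x) := by
    simp only [commB, aF_gradR_eq, gradB]
  have hX : ∀ j, ∑ l, (∑ m, (a x l m : ℂ) * pdB b j (pdB b m v) x) * conj (pdB b l v x) =
      conj (∑ l, aGradB a b v x l * conj (pdB b j (pdB b l v) x)) := by
    intro j
    rw [sum_symm_pairing hs]
    simp [aGradB]
  have hZ : ∑ j, aGradB a b v x j *
      (∑ l, (aGradR a ψ l x : ℂ) * conj (pdB b l (pdB b j v) x)) =
      ∑ j, (aGradR a ψ j x : ℂ) * ∑ l, aGradB a b v x l * conj (pdB b j (pdB b l v) x) := by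
    simp only [Finset.mul_sum]
    rw [Finset.sum_comm]
    exact Finset.sum_congr rfl fun j _ => Finset.sum_congr rfl fun l _ => by ring
  have hdiv := re_sum_divergence (fun j => aGradB a b v x j)
    (fun j => pdB b j (fun y => aGradB a b v y j) x) (fun j => pdB b j v x)
    (fun j => ∑ l, (pdR j (aGradR a ψ l) x : ℂ) * conj (pdB b l v x))
    (fun j => ∑ l, (aGradR a ψ l x : ℂ) * conj (pdB b l (pdB b j v) x))
    (fun j => ∑ l, (dbM b x j l : ℂ) * (aGradR a ψ l x : ℂ))
    (fun j => ∑ l, ∑ m, (pdR j (fun y => a y l m) x : ℂ) *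
      (pdB b m v x * conj (pdB b l v x)))
    (fun j => ∑ l, aGradB a b v x l * conj (pdB b j (pdB b l v) x))
    (fun j => aGradR a (AopR a ψ) j x) (fun j => pdR j (aGradR a (AopR a ψ) j) x)
    (fun j => pdR j (AopR a ψ) x) (fun j => aGradR a ψ j x)
    (fun j => pdR j (aGradR a ψ j) x) (fun j => pdR j c x) (v x) (c x - lam)
    (sum_aGradR_mul_pdB hs b (AopR a ψ) v) hZ
  have hA : ∑ j, pdB b j (fun y => aGradB a b v y j) x = Aop a b v x := rfl
  have hG : ∑ j, pdR j (aGradR a ψ j) x = AopR a ψ x := rfl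
  have hAG : ∑ j, pdR j (aGradR a (AopR a ψ) j) x = AopR a (AopR a ψ) x := rfl
  have hIb : 2 * (∑ j, aGradB a b v x j *
      (∑ l, (dbM b x j l : ℂ) * (aGradR a ψ l x : ℂ)) * conj (v x)).im = Ib' a b ψ v x := by
    rw [Ib']
    congr 2
    refine Finset.sum_congr rfl fun j _ => ?_
    rw [aGradB, mul_assoc, Finset.sum_mul]
    refine Finset.sum_congr rfl fun k _ => ?_
    rw [Finset.sum_mul, Finset.mul_sum]
    refine Finset.sum_congr rfl fun l _ => ?_
    rw [aGradR, Complex.ofReal_sum, Finset.mul_sum, Finset.sum_mul, Finset.mul_sum]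
    refine Finset.sum_congr rfl fun m _ => ?_
    push_cast
    ring
  have hdc : ∑ j, aGradR a ψ j x * pdR j c x = ∑ j, ∑ k, a x j k * pdR k ψ x * pdR j c x := by
    simp only [aGradR, Finset.sum_mul]
  have hα : (∑ l, ∑ m, alphLM a ψ x l m * (pdB b m v x * conj (pdB b l v x)).re) =
      2 * (∑ j, aGradB a b v x j *
        ∑ l, (pdR j (aGradR a ψ l) x : ℂ) * conj (pdB b l v x)).re -
      (∑ j, (aGradR a ψ j x : ℂ) * ∑ l, ∑ m, (pdR j (fun y => a y l m) x : ℂ) *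
        (pdB b m v x * conj (pdB b l v x))).re := by
    have h1 : ∑ j, aGradB a b v x j *
        ∑ l, (pdR j (aGradR a ψ l) x : ℂ) * conj (pdB b l v x) =
        ∑ l, ∑ m, ((∑ j, a x j m * pdR j (aGradR a ψ l) x : ℝ) : ℂ) *
          (pdB b m v x * conj (pdB b l v x)) := by
      simp only [Complex.ofReal_sum, Finset.mul_sum, Finset.sum_mul, aGradB]
      rw [Finset.sum_comm]
      refine Finset.sum_congr rfl fun l _ => ?_
      rw [Finset.sum_comm]
      refine Finset.sum_congr rfl fun m _ => Finset.sum_congr rfl fun j _ => ?_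
      push_cast
      ring
    have h2 : ∑ j, (aGradR a ψ j x : ℂ) * ∑ l, ∑ m, (pdR j (fun y => a y l m) x : ℂ) *
        (pdB b m v x * conj (pdB b l v x)) =
        ∑ l, ∑ m, ((∑ j, aGradR a ψ j x * pdR j (fun y => a y l m) x : ℝ) : ℂ) *
          (pdB b m v x * conj (pdB b l v x)) := by
      simp only [Complex.ofReal_sum, Finset.mul_sum, Finset.sum_mul]
      rw [Finset.sum_comm]
      refine Finset.sum_congr rfl fun l _ => ?_
      rw [Finset.sum_comm]
      refine Finset.sum_congr rfl fun m _ => Finset.sum_congr rfl fun j _ => ?_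
      push_cast
      ring
    rw [h1, h2]
    simp only [Complex.re_sum, Complex.re_ofReal_mul, Finset.mul_sum, ← Finset.sum_sub_distrib]
    refine Finset.sum_congr rfl fun l _ => Finset.sum_congr rfl fun m _ => ?_
    have hα' : alphLM a ψ x l m = 2 * (∑ j, a x j m * pdR j (aGradR a ψ l) x) -
        ∑ j, aGradR a ψ j x * pdR j (fun y => a y l m) x := by
      simp only [alphLM, aGradR, Finset.sum_mul]
      rfl
    rw [hα']
    ring
  rw [Finset.sum_congr rfl fun j _ => (hasPdC_Qf ha hb hc hψ hv hV).2, hα, ← hIb, ← hdc,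
    aF_gradR_eq]
  simp only [hA, hG, hAG] at hdiv
  simp only [hX, aF_gradB_eq, hC, gradB]
  rw [hdiv]
  ring


/-- **Morawetz-type multiplier identities** (Theorem 2.2 of the paper): with
`f := Aᵇv − c v + (λ + iε) v` one has, pointwise on `Ω`,
`I_{∇v} + I_v + I_ε + I_b + I_f = Re ∂ⱼ{Qⱼ + Pⱼ}` and
`∂ⱼPⱼ = a(∇ᵇv,∇ᵇv)φ + (c−λ−iε)|v|²φ + f v̄ φ − ½ Aφ |v|² + i Im a(∇ᵇv, v∇φ)`. -/
theorem morawetz_identities (n : ℕ) (Ω : Set (Euc n)) (hΩ : IsOpen Ω)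
    (a : Euc n → Matrix (Fin n) (Fin n) ℝ) (hsymm : ∀ x, (a x).IsSymm)
    (ha : ∀ j k, ContDiff ℝ 3 fun y => a y j k)
    (b : Euc n → Fin n → ℝ) (hb : ∀ j, ContDiff ℝ 2 fun y => b y j)
    (c ψ φ : Euc n → ℝ) (hc : ContDiff ℝ 1 c) (hψ : ContDiff ℝ 4 ψ)
    (hφ : ContDiff ℝ 2 φ)
    (v : Euc n → ℂ) (hv : ContDiffOn ℝ 2 v Ω)
    (lam eps : ℝ) (f : Euc n → ℂ)
    (hf : ∀ x ∈ Ω,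
      f x = Aop a b v x - (c x : ℂ) * v x + ((lam : ℂ) + eps * Complex.I) * v x) :
    ∀ x ∈ Ω,
      (Inv' a b ψ φ v x + Iv' a c ψ φ lam v x + Ieps' a b ψ eps v x +
          Ib' a b ψ v x + If' a b ψ φ v f x =
        (∑ j, pdC j (fun y => Qf a b c ψ lam v j y + Pf a b φ v j y) x).re) ∧
      (∑ j, pdC j (Pf a b φ v j) x =
        aF a x (gradB b v x) (gradB b v x) * ((φ x : ℝ) : ℂ) +
          ((c x : ℂ) - (lam : ℂ) - eps * Complex.I) * ((‖v x‖ ^ 2 : ℝ) : ℂ) *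
            ((φ x : ℝ) : ℂ) +
          f x * conj (v x) * ((φ x : ℝ) : ℂ) -
          (1 / 2) * ((AopR a φ x : ℝ) : ℂ) * ((‖v x‖ ^ 2 : ℝ) : ℂ) +
          Complex.I *
            (((aF a x (gradB b v x) (fun j => v x * (pdR j φ x : ℂ))).im : ℝ) : ℂ)) := by
  intro x hx
  have hva : ContDiffAt ℝ 2 v x := hv.contDiffAt (hΩ.mem_nhds hx)
  have hvd : DifferentiableAt ℝ v x := hva.differentiableAt (by norm_num)
  have hb1 : ∀ j, ContDiff ℝ 1 fun y => b y j := fun j => (hb j).of_le (by norm_num)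
  have ha1 : ∀ j k, ContDiff ℝ 1 fun y => a y j k := fun j k => (ha j k).of_le (by norm_num)
  have hcd : DifferentiableAt ℝ c x := hc.differentiable (by norm_num) x
  have hV : ∀ j, DifferentiableAt ℝ (fun y => aGradB a b v y j) x := fun j =>
    DifferentiableAt.fun_sum fun k _ =>
      (HasPdC.ofReal (j := j) ((ha j k).differentiable (by norm_num) x)).1.mul
        ((contDiffAt_pdB hb1 hva k).differentiableAt (by norm_num))
  have hP := sum_pdC_Pf (hsymm x) ha1 hφ hvd hV
  have hfx : Aop a b v x =
      f x + (c x : ℂ) * v x - ((lam : ℂ) + eps * Complex.I) * v x := by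
    rw [hf x hx]
    ring
  have hn := ofReal_norm_sq (v x)
  refine ⟨?_, ?_⟩
  · have hQ := re_sum_pdC_Qf (lam := lam) (hsymm x) ha hb1 hcd hψ hva hV
    have hsum : ∑ j, pdC j (fun y => Qf a b c ψ lam v j y + Pf a b φ v j y) x =
        ∑ j, pdC j (Qf a b c ψ lam v j) x + ∑ j, pdC j (Pf a b φ v j) x := by
      rw [← Finset.sum_add_distrib]
      refine Finset.sum_congr rfl fun j _ => ?_
      have h := (hasPdC_Qf (lam := lam) ha hb1 hcd hψ hva hV).add
        (hasPdC_Pf ha1 hφ hvd (hV j))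
      rw [h.2, (hasPdC_Qf ha hb1 hcd hψ hva hV).2, (hasPdC_Pf ha1 hφ hvd (hV j)).2]
    have hA : AopR a (fun y => AopR a ψ y + φ y) x = AopR a (AopR a ψ) x + AopR a φ x :=
      AopR_add ha1 (contDiff_AopR ha hψ (by norm_num) (by norm_num)) hφ x
    have hnr : ‖v x‖ ^ 2 = (v x).re * (v x).re + (v x).im * (v x).im := by
      rw [← Complex.normSq_eq_norm_sq, Complex.normSq_apply]
    rw [hsum, Complex.add_re, hQ, hP, hfx, Inv', Iv', Ieps', If', hA, commB]
    generalize aF a x (gradB b v x) (gradB b v x) = E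
    generalize aF a x (fun k => (pdR k ψ x : ℂ)) (gradB b v x) = W
    simp only [Complex.add_re, Complex.sub_re, Complex.mul_re, Complex.mul_im, Complex.add_im,
      Complex.sub_im, Complex.conj_re, Complex.conj_im, Complex.ofReal_re, Complex.ofReal_im,
      Complex.I_re, Complex.I_im, Complex.re_ofNat, Complex.im_ofNat, Complex.div_ofNat_re,
      Complex.div_ofNat_im, Complex.one_re, Complex.one_im, hnr]
    ring
  · rw [hP, hfx]
    linear_combination (-(c x : ℂ) + lam + eps * Complex.I) * (φ x : ℂ) * hn

end Morawetz

end Helmholtz
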